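/- Let α ∈ (1,2], η ∈ (0,1], 0 ≤ λ < 2/η², and let f : [0,1] × [0,∞) → [0,∞) be continuous. Suppose max_{t∈[0,1]} f(t,x)/x → 0 as x → 0⁺ and min_{t∈[0,1]} f(t,x)/x → +∞ as x → +∞. Then there exists a continuous function x : [0,1] → ℝ with x(t) ≥ 0 for all t ∈ [0,1], x not identically zero, x twice differentiable on (0,1), satisfying t^(2-α)·x''(t) + f(t, x(t)) = 0 for all t ∈ (0,1), x(0) = 0, and x(1) = λ·∫₀^η x(t) dt. -/

import Mathlib

open Set MeasureTheory Filter Topology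

/-- The solution of `x'' = -h μ`, `x 0 = 0`, `x' 0 = s`, for a measure `μ` on `[0, 1]`. -/
noncomputable def volterra (μ : Measure ℝ) (s : ℝ) (h : ℝ → ℝ) (t : ℝ) : ℝ :=
  s * t - ∫ τ in Icc (0 : ℝ) 1, max (t - τ) 0 * h τ ∂μ

section Volterra

variable {μ : Measure ℝ} {s : ℝ} {h : ℝ → ℝ}

lemma integrableOn_volterra [IsFiniteMeasure μ] (hc : Continuous h) (t : ℝ) :
    IntegrableOn (fun τ => max (t - τ) 0 * h τ) (Icc 0 1) μ :=
  Continuous.integrableOn_Icc (by fun_prop)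

lemma volterra_of_nonpos {t : ℝ} (ht : t ≤ 0) : volterra μ s h t = s * t := by
  have : ∫ τ in Icc (0 : ℝ) 1, max (t - τ) 0 * h τ ∂μ = 0 := by
    rw [setIntegral_congr_fun (g := fun _ => (0 : ℝ)) measurableSet_Icc]
    · simp
    · intro τ hτ
      simp [max_eq_right (show t - τ ≤ 0 by linarith [hτ.1])]
  simp [volterra, this]

lemma volterra_congr {h' : ℝ → ℝ} {t : ℝ} (hh : ∀ τ ∈ Icc (0 : ℝ) 1, τ < t → h τ = h' τ) :
    volterra μ s h t = volterra μ s h' t := by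
  unfold volterra
  congr 1
  refine setIntegral_congr_fun measurableSet_Icc fun τ hτ => ?_
  rcases lt_or_ge τ t with hlt | hge
  · simp only [hh τ hτ hlt]
  · simp [max_eq_right (sub_nonpos.2 hge)]

lemma volterra_le (h0 : ∀ τ ∈ Icc (0 : ℝ) 1, 0 ≤ h τ) (t : ℝ) : volterra μ s h t ≤ s * t := by
  have : 0 ≤ ∫ τ in Icc (0 : ℝ) 1, max (t - τ) 0 * h τ ∂μ :=
    setIntegral_nonneg measurableSet_Icc fun τ hτ => mul_nonneg (le_max_right _ _) (h0 τ hτ)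
  unfold volterra
  linarith

lemma le_volterra [IsFiniteMeasure μ] {M t : ℝ} (hc : Continuous h) (ht : t ∈ Icc (0 : ℝ) 1)
    (h0 : ∀ τ ∈ Icc (0 : ℝ) 1, 0 ≤ h τ) (hM : ∀ τ ∈ Icc (0 : ℝ) 1, h τ ≤ M) :
    s * t - M * μ.real (Icc 0 1) ≤ volterra μ s h t := by
  have : ∫ τ in Icc (0 : ℝ) 1, max (t - τ) 0 * h τ ∂μ ≤ ∫ τ in Icc (0 : ℝ) 1, M ∂μ := by
    refine setIntegral_mono_on (integrableOn_volterra hc t) (by simp) measurableSet_Icc ?_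
    intro τ hτ
    have h1 : max (t - τ) 0 ≤ 1 := max_le (by linarith [ht.2, hτ.1]) zero_le_one
    nlinarith [h0 τ hτ, hM τ hτ, le_max_right (t - τ) 0]
  rw [setIntegral_const, smul_eq_mul, mul_comm] at this
  unfold volterra
  linarith

lemma concaveOn_volterra [IsFiniteMeasure μ] (hc : Continuous h) (h0 : ∀ τ ∈ Icc (0 : ℝ) 1, 0 ≤ h τ) :
    ConcaveOn ℝ univ (volterra μ s h) := by
  refine ⟨convex_univ, fun x _ y _ a b ha hb hab => ?_⟩
  have key : ∫ τ in Icc (0 : ℝ) 1, max (a * x + b * y - τ) 0 * h τ ∂μ ≤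
      ∫ τ in Icc (0 : ℝ) 1, (a * (max (x - τ) 0 * h τ) + b * (max (y - τ) 0 * h τ)) ∂μ := by
    refine setIntegral_mono_on (integrableOn_volterra hc _)
      (((integrableOn_volterra hc x).const_mul a).add ((integrableOn_volterra hc y).const_mul b))
      measurableSet_Icc fun τ hτ => ?_
    have : max (a * x + b * y - τ) 0 ≤ a * max (x - τ) 0 + b * max (y - τ) 0 := by
      refine max_le ?_ (by positivity)
      have e : τ = a * τ + b * τ := by rw [← add_mul, hab, one_mul]
      nlinarith [mul_le_mul_of_nonneg_left (le_max_left (x - τ) 0) ha,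
        mul_le_mul_of_nonneg_left (le_max_left (y - τ) 0) hb]
    nlinarith [mul_le_mul_of_nonneg_right this (h0 τ hτ)]
  rw [integral_add ((integrableOn_volterra hc x).const_mul a)
    ((integrableOn_volterra hc y).const_mul b), integral_const_mul, integral_const_mul] at key
  simp only [volterra, smul_eq_mul]
  linarith

lemma lipschitz_volterra [IsFiniteMeasure μ] {M : ℝ} (hc : Continuous h)
    (h0 : ∀ τ ∈ Icc (0 : ℝ) 1, 0 ≤ h τ) (hM : ∀ τ ∈ Icc (0 : ℝ) 1, h τ ≤ M) (x y : ℝ) :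
    |volterra μ s h x - volterra μ s h y| ≤ (|s| + M * μ.real (Icc 0 1)) * |x - y| := by
  have key : ‖∫ τ in Icc (0 : ℝ) 1, (max (x - τ) 0 * h τ - max (y - τ) 0 * h τ) ∂μ‖ ≤
      (|x - y| * M) * μ.real (Icc 0 1) := by
    refine norm_setIntegral_le_of_norm_le_const (measure_lt_top _ _) fun τ hτ => ?_
    rw [← sub_mul, norm_mul, Real.norm_eq_abs, Real.norm_eq_abs, abs_of_nonneg (h0 τ hτ)]
    refine mul_le_mul ?_ (hM τ hτ) (h0 τ hτ) (abs_nonneg _)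
    simpa using abs_max_sub_max_le_abs (x - τ) (y - τ) 0
  rw [integral_sub (integrableOn_volterra hc x) (integrableOn_volterra hc y),
    Real.norm_eq_abs] at key
  have e : volterra μ s h x - volterra μ s h y = s * (x - y) -
      (∫ τ in Icc (0 : ℝ) 1, max (x - τ) 0 * h τ ∂μ -
        ∫ τ in Icc (0 : ℝ) 1, max (y - τ) 0 * h τ ∂μ) := by
    unfold volterra; ring
  rw [e]
  refine (abs_sub _ _).trans ?_
  rw [abs_mul]
  linarith

lemma volterra_half_ge [IsFiniteMeasure μ] {c : ℝ} (hc : Continuous h) (h0 : ∀ τ ∈ Icc (0 : ℝ) 1, 0 ≤ h τ)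
    (hge : ∀ τ ∈ Icc (1 / 4 : ℝ) (3 / 4), c ≤ h τ) (c0 : 0 ≤ c) :
    c / 8 * μ.real (Icc (1 / 4) (3 / 4)) ≤
      volterra μ s h (1 / 2) - volterra μ s h 1 / 2 := by
  have hker : ∀ τ ∈ Icc (0 : ℝ) 1, 0 ≤ max (1 - τ) 0 / 2 - max (1 / 2 - τ) 0 := fun τ hτ => by
    rw [max_eq_left (by linarith [hτ.2])]
    rcases max_cases (1 / 2 - τ) 0 with ⟨h1, _⟩ | ⟨h1, _⟩ <;> rw [h1] <;> linarith [hτ.1, hτ.2]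
  have hint : ∀ a b : ℝ, IntegrableOn
      (fun τ => (max (1 - τ) 0 / 2 - max (1 / 2 - τ) 0) * h τ) (Icc a b) μ :=
    fun a b => Continuous.integrableOn_Icc (by fun_prop)
  have e : volterra μ s h (1 / 2) - volterra μ s h 1 / 2 =
      ∫ τ in Icc (0 : ℝ) 1, (max (1 - τ) 0 / 2 - max (1 / 2 - τ) 0) * h τ ∂μ := by
    have : ∀ τ, (max (1 - τ) 0 / 2 - max (1 / 2 - τ) 0) * h τ =
        (max (1 - τ) 0 * h τ) / 2 - max (1 / 2 - τ) 0 * h τ := fun τ => by ring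
    simp_rw [this]
    rw [integral_sub ((integrableOn_volterra hc 1).div_const 2) (integrableOn_volterra hc _),
      integral_div]
    unfold volterra; ring
  rw [e]
  refine le_trans ?_ (setIntegral_mono_set (s := Icc (1 / 4) (3 / 4)) (hint 0 1) ?_ ?_)
  · refine setIntegral_ge_of_const_le_real measurableSet_Icc (measure_ne_top _ _) ?_ (hint _ _)
    intro τ hτ
    have : 1 / 8 ≤ max (1 - τ) 0 / 2 - max (1 / 2 - τ) 0 := by
      rw [max_eq_left (by linarith [hτ.2])]
      rcases max_cases (1 / 2 - τ) 0 with ⟨h1, _⟩ | ⟨h1, _⟩ <;> rw [h1] <;> linarith [hτ.1, hτ.2]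
    nlinarith [hge τ hτ]
  · filter_upwards [ae_restrict_mem measurableSet_Icc] with τ hτ
    exact mul_nonneg (hker τ hτ) (h0 τ hτ)
  · exact (Icc_subset_Icc (by norm_num) (by norm_num)).eventuallyLE

end Volterra

section Delay

/-- Picard iteration for the delayed problem `x'' = -g(t, x(t - δ)) μ`, `x 0 = 0`, `x' 0 = s`. -/
noncomputable def delayIter (μ : Measure ℝ) (g : ℝ → ℝ → ℝ) (δ : ℝ) : ℕ → ℝ → ℝ → ℝ
  | 0 => fun s t => s * t
  | k + 1 => fun s t => volterra μ s (fun τ => g τ (delayIter μ g δ k s (τ - δ))) t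

variable {μ : Measure ℝ} {g : ℝ → ℝ → ℝ} {δ : ℝ}

lemma continuous_delayIter [IsFiniteMeasure μ] (hg : Continuous (Function.uncurry g)) (k : ℕ) :
    Continuous (Function.uncurry (delayIter μ g δ k)) := by
  induction k with
  | zero => simp only [delayIter, Function.uncurry_def]; fun_prop
  | succ k ih =>
    simp only [delayIter, volterra, Function.uncurry_def]
    refine Continuous.sub (by fun_prop) ?_
    refine continuous_parametric_integral_of_continuous (X := ℝ × ℝ)
      (f := fun p τ => max (p.2 - τ) 0 * g τ (delayIter μ g δ k p.1 (τ - δ))) ?_ isCompact_Icc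
    have h1 : Continuous fun q : (ℝ × ℝ) × ℝ => delayIter μ g δ k q.1.1 (q.2 - δ) :=
      ih.comp (f := fun q : (ℝ × ℝ) × ℝ => (q.1.1, q.2 - δ)) (by fun_prop)
    have h2 : Continuous fun q : (ℝ × ℝ) × ℝ => g q.2 (delayIter μ g δ k q.1.1 (q.2 - δ)) :=
      hg.comp (continuous_snd.prodMk h1)
    simp only [Function.uncurry_def]
    fun_prop

lemma delayIter_succ_eq (k : ℕ) (s t : ℝ) (ht : t ≤ k * δ) :
    delayIter μ g δ (k + 1) s t = delayIter μ g δ k s t := by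
  induction k generalizing t with
  | zero => simpa [delayIter] using volterra_of_nonpos (by simpa using ht)
  | succ k ih =>
    refine volterra_congr fun τ _ hτt => congrArg (g τ) (ih _ ?_)
    push_cast at ht
    linarith

lemma exists_delay_solution [IsFiniteMeasure μ] (hg : Continuous (Function.uncurry g))
    (hδ : 0 < δ) : ∃ u : ℝ → ℝ → ℝ, Continuous (Function.uncurry u) ∧
      ∀ s t, u s t = volterra μ s (fun τ => g τ (u s (τ - δ))) t := by
  obtain ⟨N, hN⟩ := exists_nat_gt (1 / δ)
  refine ⟨delayIter μ g δ (N + 1), continuous_delayIter hg _, fun s t => ?_⟩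
  rw [delayIter]
  refine volterra_congr fun τ hτ _ => ?_
  have h1 : τ - δ ≤ N * δ := by
    rw [div_lt_iff₀ hδ] at hN
    linarith [hτ.2]
  have := delayIter_succ_eq (μ := μ) (g := g) N s (τ - δ) h1
  rw [← this, delayIter]

end Delay

section Concave

variable {x : ℝ → ℝ}

lemma ConcaveOn.mul_le_of_map_zero (hx : ConcaveOn ℝ univ x) (h0 : x 0 = 0) {a : ℝ}
    (ha0 : 0 ≤ a) (ha1 : a ≤ 1) (t : ℝ) : a * x t ≤ x (a * t) := by
  have := hx.2 (mem_univ t) (mem_univ 0) ha0 (sub_nonneg.2 ha1) (by ring)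
  simpa [h0] using this

lemma ConcaveOn.mul_le_of_map_one_nonneg (hx : ConcaveOn ℝ univ x) (h1 : 0 ≤ x 1) {a : ℝ}
    (ha0 : 0 ≤ a) (ha1 : a ≤ 1) (t : ℝ) : a * x t ≤ x (a * t + (1 - a)) := by
  have := hx.2 (mem_univ t) (mem_univ 1) ha0 (sub_nonneg.2 ha1) (by ring)
  simp only [smul_eq_mul, mul_one] at this
  nlinarith [mul_nonneg (sub_nonneg.2 ha1) h1]

lemma ConcaveOn.half_bounds (hx : ConcaveOn ℝ univ x) (h0 : x 0 = 0) (h1 : 0 ≤ x 1) :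
    0 ≤ x (1 / 2) ∧ (∀ t ∈ Icc (1 / 8 : ℝ) (3 / 4), x (1 / 2) / 4 ≤ x t) ∧
      ∀ t ∈ Icc (0 : ℝ) 1, x t ≤ 2 * x (1 / 2) := by
  have hh : 0 ≤ x (1 / 2) := by
    have := hx.mul_le_of_map_zero h0 (a := 1 / 2) (by norm_num) (by norm_num) 1
    rw [mul_one] at this
    linarith
  refine ⟨hh, fun t ht => ?_, fun t ht => ?_⟩
  · rcases le_total t (1 / 2) with h | h
    · have := hx.mul_le_of_map_zero h0 (a := 2 * t) (by linarith [ht.1]) (by linarith) (1 / 2)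
      rw [show 2 * t * (1 / 2) = t by ring] at this
      nlinarith [ht.1]
    · have := hx.mul_le_of_map_one_nonneg h1 (a := 2 * (1 - t)) (by linarith [ht.2])
        (by linarith) (1 / 2)
      rw [show 2 * (1 - t) * (1 / 2) + (1 - 2 * (1 - t)) = t by ring] at this
      nlinarith [ht.2]
  · rcases le_total t (1 / 2) with h | h
    · have hp : 0 < 1 - t := by linarith
      have := hx.mul_le_of_map_one_nonneg h1 (a := 1 / (2 * (1 - t))) (by positivity)
        (by rw [div_le_one (by positivity)]; linarith) t
      rw [show 1 / (2 * (1 - t)) * t + (1 - 1 / (2 * (1 - t))) = 1 / 2 by field_simp; ring,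
        div_mul_eq_mul_div, one_mul, div_le_iff₀ (by positivity)] at this
      nlinarith [ht.1]
    · have hp : 0 < t := by linarith
      have := hx.mul_le_of_map_zero h0 (a := 1 / (2 * t)) (by positivity)
        (by rw [div_le_one (by positivity)]; linarith) t
      rw [show 1 / (2 * t) * t = 1 / 2 by field_simp,
        div_mul_eq_mul_div, one_mul, div_le_iff₀ (by positivity)] at this
      nlinarith [ht.2]

lemma ConcaveOn.map_one_nonneg (hx : ConcaveOn ℝ univ x) (hc : Continuous x) (h0 : x 0 = 0)
    {lam η : ℝ} (hη : η ∈ Ioc (0 : ℝ) 1) (hlam0 : 0 ≤ lam) (hlam : lam < 2 / η ^ 2)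
    (h1 : lam * ∫ t in (0 : ℝ)..η, x t ≤ x 1) : 0 ≤ x 1 := by
  have hη2 : 0 < η ^ 2 := pow_pos hη.1 2
  rw [lt_div_iff₀ hη2] at hlam
  have key : ∫ t in (0 : ℝ)..η, t * x 1 ≤ ∫ t in (0 : ℝ)..η, x t := by
    refine intervalIntegral.integral_mono_on hη.1.le
      (Continuous.intervalIntegrable (by fun_prop) _ _) (hc.intervalIntegrable _ _) fun t ht => ?_
    simpa using hx.mul_le_of_map_zero h0 ht.1 (ht.2.trans hη.2) 1
  rw [intervalIntegral.integral_mul_const, integral_id] at key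
  nlinarith [mul_le_mul_of_nonneg_left key hlam0]

end Concave

section Bounds

variable {μ : Measure ℝ} [IsFiniteMeasure μ] {g : ℝ → ℝ → ℝ}

lemma exists_bound_of_le (hg : Continuous (Function.uncurry g))
    (hgz : ∀ τ ∈ Icc (0 : ℝ) 1, ∀ u ≤ 0, g τ u = 0) (S : ℝ) :
    ∃ M, 0 ≤ M ∧ ∀ τ ∈ Icc (0 : ℝ) 1, ∀ u ≤ S, g τ u ≤ M := by
  obtain ⟨M, hM⟩ := ((isCompact_Icc (a := (0 : ℝ)) (b := 1)).prod
    (isCompact_Icc (a := (0 : ℝ)) (b := S))).bddAbove_image hg.continuousOn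
  refine ⟨max M 0, le_max_right _ _, fun τ hτ u hu => ?_⟩
  rcases le_total u 0 with h | h
  · simp [hgz τ hτ u h]
  · exact le_max_of_le_left (hM ⟨(τ, u), ⟨hτ, h, hu⟩, rfl⟩)

lemma exists_slope_bound (hμ : 0 < μ.real (Icc (1 / 4) (3 / 4)))
    (hg : Continuous (Function.uncurry g))
    (hg0 : ∀ τ ∈ Icc (0 : ℝ) 1, ∀ u, 0 ≤ g τ u)
    (hgz : ∀ τ ∈ Icc (0 : ℝ) 1, ∀ u ≤ 0, g τ u = 0)
    (hginf : ∀ N, ∃ K, 0 < K ∧ ∀ τ ∈ Icc (0 : ℝ) 1, ∀ u, K ≤ u → N * u ≤ g τ u) :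
    ∃ S, ∀ δ ∈ Ioc (0 : ℝ) (1 / 8), ∀ s, 0 < s → ∀ x : ℝ → ℝ, Continuous x →
      (∀ t, x t = volterra μ s (fun τ => g τ (x (τ - δ))) t) → 0 ≤ x 1 → s ≤ S := by
  set m := μ.real (Icc (1 / 4) (3 / 4))
  obtain ⟨K, hK, hKg⟩ := hginf (64 / m)
  obtain ⟨M, hM0, hM⟩ := exists_bound_of_le hg hgz (8 * K)
  refine ⟨8 * K + M * μ.real (Icc 0 1), fun δ hδ s hs x hxc hx h1 => ?_⟩
  set h : ℝ → ℝ := fun τ => g τ (x (τ - δ))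
  have hc : Continuous h := hg.comp (f := fun τ => (τ, x (τ - δ))) (by fun_prop)
  have h0 : ∀ τ ∈ Icc (0 : ℝ) 1, 0 ≤ h τ := fun τ hτ => hg0 τ hτ _
  have hxe : x = volterra μ s h := funext hx
  have hconc : ConcaveOn ℝ univ x := hxe ▸ concaveOn_volterra hc h0
  have hneg : ∀ t ≤ 0, x t = s * t := fun t ht => by rw [hx, volterra_of_nonpos ht]
  obtain ⟨hhalf, hlow, hup⟩ := hconc.half_bounds (by simp [hneg 0 le_rfl]) h1
  have hlt : x (1 / 2) < 4 * K := by
    by_contra! hcon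
    have hge : ∀ τ ∈ Icc (1 / 4 : ℝ) (3 / 4), 64 / m * (x (1 / 2) / 4) ≤ h τ := fun τ hτ => by
      have hl := hlow (τ - δ) ⟨by linarith [hτ.1, hδ.2], by linarith [hτ.2, hδ.1]⟩
      refine le_trans ?_ (hKg τ ⟨by linarith [hτ.1], by linarith [hτ.2]⟩ _ (by linarith))
      exact mul_le_mul_of_nonneg_left hl (by positivity)
    have := volterra_half_ge (μ := μ) (s := s) hc h0 hge (by positivity)
    rw [← hxe] at this
    have e : 64 / m * (x (1 / 2) / 4) / 8 * m = 2 * x (1 / 2) := by field_simp; ring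
    rw [show μ.real (Icc (1 / 4) (3 / 4)) = m from rfl, e] at this
    linarith
  have hhM : ∀ τ ∈ Icc (0 : ℝ) 1, h τ ≤ M := fun τ hτ => by
    refine hM τ hτ _ ?_
    rcases le_total (τ - δ) 0 with h' | h'
    · rw [hneg _ h']
      nlinarith
    · linarith [hup (τ - δ) ⟨h', by linarith [hτ.2, hδ.1]⟩]
  have := le_volterra (μ := μ) (s := s) hc (right_mem_Icc.2 zero_le_one) h0 hhM
  rw [← hxe] at this
  linarith [hup 1 (right_mem_Icc.2 zero_le_one)]

lemma exists_small_slope (hg : Continuous (Function.uncurry g))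
    (hg0 : ∀ τ ∈ Icc (0 : ℝ) 1, ∀ u, 0 ≤ g τ u)
    (hgz : ∀ τ ∈ Icc (0 : ℝ) 1, ∀ u ≤ 0, g τ u = 0)
    (hgzero : ∀ ε > 0, ∃ r, 0 < r ∧ ∀ τ ∈ Icc (0 : ℝ) 1, ∀ u ∈ Icc 0 r, g τ u ≤ ε * u)
    {lam η : ℝ} (hη : η ∈ Ioc (0 : ℝ) 1) (hlam0 : 0 ≤ lam) (hlam : lam < 2 / η ^ 2) :
    ∃ s, 0 < s ∧ ∀ δ, 0 < δ → ∀ x : ℝ → ℝ, Continuous x →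
      (∀ t, x t = volterra μ s (fun τ => g τ (x (τ - δ))) t) →
      lam * ∫ t in (0 : ℝ)..η, x t < x 1 := by
  have hη2 : 0 < η ^ 2 := pow_pos hη.1 2
  rw [lt_div_iff₀ hη2] at hlam
  set m := μ.real (Icc 0 1)
  have hm : 0 ≤ m := measureReal_nonneg
  set ε := (1 - lam * η ^ 2 / 2) / (2 * (m + 1)) with hε
  have hε0 : 0 < ε := div_pos (by linarith) (by positivity)
  have hεm : ε * m < 1 - lam * η ^ 2 / 2 := by
    have : ε * (2 * (m + 1)) = 1 - lam * η ^ 2 / 2 := by rw [hε]; field_simp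
    nlinarith
  obtain ⟨s, hs, hsg⟩ := hgzero ε hε0
  refine ⟨s, hs, fun δ hδ x hxc hx => ?_⟩
  set h : ℝ → ℝ := fun τ => g τ (x (τ - δ)) with hh
  have hc : Continuous h := hg.comp (f := fun τ => (τ, x (τ - δ))) (by fun_prop)
  have h0 : ∀ τ ∈ Icc (0 : ℝ) 1, 0 ≤ h τ := fun τ hτ => hg0 τ hτ _
  have hle : ∀ t, x t ≤ s * t := fun t => hx t ▸ volterra_le h0 t
  have hM : ∀ τ ∈ Icc (0 : ℝ) 1, h τ ≤ ε * s := fun τ hτ => by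
    rcases le_total (x (τ - δ)) 0 with h' | h'
    · simp only [hh, hgz τ hτ _ h']
      positivity
    · have hxs : x (τ - δ) ≤ s := (hle _).trans (by nlinarith [hτ.2])
      exact (hsg τ hτ _ ⟨h', hxs⟩).trans (by gcongr)
  have h1 := le_volterra (μ := μ) (s := s) hc (right_mem_Icc.2 zero_le_one) h0 hM
  rw [← hx, mul_one] at h1
  have key : ∫ t in (0 : ℝ)..η, x t ≤ ∫ t in (0 : ℝ)..η, s * t :=
    intervalIntegral.integral_mono_on hη.1.le (hxc.intervalIntegrable _ _)
      (Continuous.intervalIntegrable (by fun_prop) _ _) fun t _ => hle t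
  rw [intervalIntegral.integral_const_mul, integral_id] at key
  have h2 := mul_le_mul_of_nonneg_left key hlam0
  have h3 := mul_lt_mul_of_pos_right hεm hs
  change s - ε * s * m ≤ x 1 at h1
  nlinarith

end Bounds

lemma exists_subseq_tendsto_of_lipschitz {L : ℝ} {x : ℕ → ℝ → ℝ} (h0 : ∀ n, x n 0 = 0)
    (hL : ∀ n t t', |x n t - x n t'| ≤ L * |t - t'|) :
    ∃ (y : ℝ → ℝ) (φ : ℕ → ℕ), StrictMono φ ∧ Continuous y ∧
      ∀ t ∈ Icc (0 : ℝ) 1, Tendsto (fun n => x (φ n) t) atTop (𝓝 (y t)) := by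
  have hL0 : 0 ≤ L := by simpa using (abs_nonneg _).trans (hL 0 1 0)
  have hlip : ∀ n, LipschitzWith L.toNNReal (fun t : Icc (0 : ℝ) 1 => x n t) := fun n =>
    LipschitzWith.of_dist_le_mul fun a b => by
      rw [Real.coe_toNNReal _ hL0]
      exact hL n a b
  let F : ℕ → BoundedContinuousFunction (Icc (0 : ℝ) 1) ℝ := fun n =>
    BoundedContinuousFunction.mkOfCompact ⟨fun t : Icc (0 : ℝ) 1 => x n t, (hlip n).continuous⟩
  have hcomp : IsCompact (closure (range F)) := by
    refine BoundedContinuousFunction.arzela_ascoli (Icc (-L) L) isCompact_Icc _ ?_ ?_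
    · rintro _ t ⟨n, rfl⟩
      have := hL n t 0
      rw [h0, sub_zero, sub_zero, abs_of_nonneg t.2.1] at this
      exact abs_le.1 (this.trans (mul_le_of_le_one_right hL0 t.2.2))
    · refine (LipschitzWith.uniformEquicontinuous _ L.toNNReal ?_).equicontinuous
      rintro ⟨_, n, rfl⟩
      exact hlip n
  obtain ⟨G, -, φ, hφ, hG⟩ := hcomp.tendsto_subseq fun n => subset_closure (mem_range_self n)
  refine ⟨IccExtend zero_le_one G, φ, hφ, G.continuous.Icc_extend', fun t ht => ?_⟩
  rw [IccExtend_of_mem _ _ ht]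
  exact (BoundedContinuousFunction.tendsto_iff_tendstoUniformly.1 hG).tendsto_at ⟨t, ht⟩

lemma exists_integral_solution {μ : Measure ℝ} [IsFiniteMeasure μ] {g : ℝ → ℝ → ℝ}
    (hμ : 0 < μ.real (Icc (1 / 4) (3 / 4)))
    (hg : Continuous (Function.uncurry g))
    (hg0 : ∀ τ ∈ Icc (0 : ℝ) 1, ∀ u, 0 ≤ g τ u)
    (hgz : ∀ τ ∈ Icc (0 : ℝ) 1, ∀ u ≤ 0, g τ u = 0)
    (hgzero : ∀ ε > 0, ∃ r, 0 < r ∧ ∀ τ ∈ Icc (0 : ℝ) 1, ∀ u ∈ Icc 0 r, g τ u ≤ ε * u)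
    (hginf : ∀ N, ∃ K, 0 < K ∧ ∀ τ ∈ Icc (0 : ℝ) 1, ∀ u, K ≤ u → N * u ≤ g τ u)
    {lam η : ℝ} (hη : η ∈ Ioc (0 : ℝ) 1) (hlam0 : 0 ≤ lam) (hlam : lam < 2 / η ^ 2) :
    ∃ (s : ℝ) (x : ℝ → ℝ), 0 < s ∧ Continuous x ∧
      (∀ t, x t = volterra μ s (fun τ => g τ (x τ)) t) ∧
      x 1 = lam * ∫ t in (0 : ℝ)..η, x t := by
  obtain ⟨s₀, hs₀, hpos⟩ := exists_small_slope (μ := μ) hg hg0 hgz hgzero hη hlam0 hlam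
  obtain ⟨S', hS'⟩ := exists_slope_bound hμ hg hg0 hgz hginf
  set S := max s₀ (S' + 1)
  set δ : ℕ → ℝ := fun n => 1 / 8 / ((n : ℝ) + 1) with hδdef
  have hδ : ∀ n, δ n ∈ Ioc (0 : ℝ) (1 / 8) := fun n =>
    ⟨by positivity, div_le_self (by norm_num) (by linarith [n.cast_nonneg (α := ℝ)])⟩
  have hδ0 : Tendsto δ atTop (𝓝 0) := by
    have := (tendsto_one_div_add_atTop_nhds_zero_nat (𝕜 := ℝ)).const_mul (1 / 8)
    simpa [hδdef, div_eq_mul_inv] using this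
  have hh : ∀ (x : ℝ → ℝ) d, Continuous x → Continuous fun τ => g τ (x (τ - d)) :=
    fun x d hx => hg.comp (f := fun τ => (τ, x (τ - d))) (by fun_prop)
  have happrox : ∀ n, ∃ (s : ℝ) (x : ℝ → ℝ), s ∈ Icc s₀ S ∧ Continuous x ∧
      (∀ t, x t = volterra μ s (fun τ => g τ (x (τ - δ n))) t) ∧
      x 1 = lam * ∫ t in (0 : ℝ)..η, x t := fun n => by
    obtain ⟨u, huc, hu⟩ := exists_delay_solution (μ := μ) hg (hδ n).1
    have hus : ∀ s, Continuous (u s) := fun s =>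
      huc.comp (f := fun t => (s, t)) (by fun_prop)
    have hB : Continuous fun s => u s 1 - lam * ∫ t in (0 : ℝ)..η, u s t :=
      (huc.comp (f := fun s => (s, (1 : ℝ))) (by fun_prop)).sub
        (continuous_const.mul
          (intervalIntegral.continuous_parametric_intervalIntegral_of_continuous' huc 0 η))
    have hS : u S 1 - lam * ∫ t in (0 : ℝ)..η, u S t ≤ 0 := by
      by_contra! hcon
      have hconc : ConcaveOn ℝ univ (u S) := by
        rw [funext (hu S)]
        exact concaveOn_volterra (hh _ _ (hus S)) fun τ hτ => hg0 τ hτ _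
      have h1 := hconc.map_one_nonneg (hus S) (by rw [hu, volterra_of_nonpos le_rfl, mul_zero]) hη hlam0
        hlam (by linarith)
      have := hS' (δ n) (hδ n) S (hs₀.trans_le (le_max_left _ _)) (u S) (hus S) (hu S) h1
      linarith [le_max_right s₀ (S' + 1)]
    have h0 := hpos (δ n) (hδ n).1 (u s₀) (hus s₀) (hu s₀)
    obtain ⟨s, hs, hsB⟩ := intermediate_value_Icc' (le_max_left s₀ (S' + 1))
      hB.continuousOn ⟨hS, sub_nonneg.2 h0.le⟩
    exact ⟨s, u s, hs, hus s, hu s, sub_eq_zero.1 hsB⟩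
  choose s x hs hxc hx hxB using happrox
  have hS0 : 0 ≤ S := hs₀.le.trans (le_max_left _ _)
  obtain ⟨M, hM0, hM⟩ := exists_bound_of_le hg hgz S
  have hle : ∀ n t, x n t ≤ s n * t := fun n t => by
    rw [hx]
    exact volterra_le (fun τ hτ => hg0 τ hτ _) t
  have hgM : ∀ n, ∀ τ ∈ Icc (0 : ℝ) 1, g τ (x n (τ - δ n)) ≤ M := fun n τ hτ => by
    refine hM τ hτ _ ((hle n _).trans ?_)
    nlinarith [(hs n).1, (hs n).2, hτ.2, (hδ n).1]
  set L := S + M * μ.real (Icc 0 1)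
  have hL0 : 0 ≤ L := by positivity
  have hx0 : ∀ n, x n 0 = 0 := fun n => by rw [hx, volterra_of_nonpos le_rfl, mul_zero]
  have hL : ∀ n t t', |x n t - x n t'| ≤ L * |t - t'| := fun n t t' => by
    rw [hx n t, hx n t']
    refine (lipschitz_volterra (hh _ _ (hxc n)) (fun τ hτ => hg0 τ hτ _) (hgM n) t t').trans ?_
    have : |s n| ≤ S := by rw [abs_of_nonneg (hs₀.le.trans (hs n).1)]; exact (hs n).2
    exact mul_le_mul_of_nonneg_right (by linarith) (abs_nonneg _)
  obtain ⟨y, φ, hφ, hyc, hy⟩ := exists_subseq_tendsto_of_lipschitz hx0 hL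
  obtain ⟨s', hs', ψ, hψ, hsψ⟩ := isCompact_Icc.tendsto_subseq fun n => hs (φ n)
  set θ : ℕ → ℕ := fun n => φ (ψ n)
  have hθ : Tendsto θ atTop atTop := hφ.tendsto_atTop.comp hψ.tendsto_atTop
  have hyθ : ∀ t ∈ Icc (0 : ℝ) 1, Tendsto (fun n => x (θ n) t) atTop (𝓝 (y t)) :=
    fun t ht => (hy t ht).comp hψ.tendsto_atTop
  have hydelay : ∀ t ∈ Icc (0 : ℝ) 1,
      Tendsto (fun n => x (θ n) (t - δ (θ n))) atTop (𝓝 (y t)) := fun t ht => by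
    have hz : Tendsto (fun n => x (θ n) (t - δ (θ n)) - x (θ n) t) atTop (𝓝 0) := by
      refine squeeze_zero_norm (a := fun n => L * δ (θ n)) (fun n => ?_) ?_
      · refine (hL _ _ _).trans_eq ?_
        rw [sub_sub_cancel_left, abs_neg, abs_of_pos (hδ _).1]
      · simpa using (hδ0.comp hθ).const_mul L
    simpa using hz.add (hyθ t ht)
  have hyeq : ∀ t ∈ Icc (0 : ℝ) 1, y t = volterra μ s' (fun τ => g τ (y τ)) t := fun t ht => by
    refine tendsto_nhds_unique (hyθ t ht) ?_
    simp_rw [hx _ t]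
    refine (hsψ.mul_const t).sub (tendsto_integral_of_dominated_convergence (fun _ => M) ?_ ?_ ?_ ?_)
    · exact fun n => (integrableOn_volterra (hh _ _ (hxc _)) t).aestronglyMeasurable
    · exact integrable_const _
    · intro n
      filter_upwards [ae_restrict_mem measurableSet_Icc] with τ hτ
      rw [Real.norm_eq_abs, abs_of_nonneg (mul_nonneg (le_max_right _ _) (hg0 τ hτ _))]
      refine (mul_le_of_le_one_left (hg0 τ hτ _) (max_le ?_ zero_le_one)).trans (hgM _ τ hτ)
      linarith [hτ.1, ht.2]
    · filter_upwards [ae_restrict_mem measurableSet_Icc] with τ hτ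
      refine Tendsto.const_mul _ ?_
      exact (hg.tendsto (τ, y τ)).comp (tendsto_const_nhds.prodMk_nhds (hydelay τ hτ))
  have hyB : y 1 = lam * ∫ t in (0 : ℝ)..η, y t := by
    refine tendsto_nhds_unique (hyθ 1 (right_mem_Icc.2 zero_le_one)) ?_
    simp_rw [hxB]
    refine Tendsto.const_mul _
      (intervalIntegral.tendsto_integral_filter_of_dominated_convergence (fun _ => L) ?_ ?_ ?_ ?_)
    · exact Eventually.of_forall fun n => (hxc _).aestronglyMeasurable
    · refine Eventually.of_forall fun n => ae_of_all _ fun t ht => ?_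
      rw [uIoc_of_le hη.1.le] at ht
      have := hL (θ n) t 0
      rw [hx0, sub_zero, sub_zero, abs_of_pos ht.1] at this
      exact this.trans (mul_le_of_le_one_right hL0 (ht.2.trans hη.2))
    · exact intervalIntegrable_const
    · refine ae_of_all _ fun t ht => ?_
      rw [uIoc_of_le hη.1.le] at ht
      exact hyθ t ⟨ht.1.le, ht.2.trans hη.2⟩
  have hyg : Continuous fun τ => g τ (y τ) := by simpa using hh y 0 hyc
  refine ⟨s', volterra μ s' fun τ => g τ (y τ), hs₀.trans_le hs'.1, ?_, fun t => ?_, ?_⟩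
  · exact continuousOn_univ.1
      ((concaveOn_volterra hyg fun τ hτ => hg0 τ hτ _).continuousOn isOpen_univ)
  · exact volterra_congr fun τ hτ _ => by rw [← hyeq τ hτ]
  · rw [← hyeq 1 (right_mem_Icc.2 zero_le_one), hyB]
    congr 1
    refine intervalIntegral.integral_congr fun t ht => hyeq t ?_
    rw [uIcc_of_le hη.1.le] at ht
    exact ⟨ht.1, ht.2.trans hη.2⟩

section PowerWeight

/-- The measure `τ ^ r dτ` on `[0, 1]`. -/
noncomputable def rpowMeasure (r : ℝ) : Measure ℝ :=
  (volume.restrict (Icc (0 : ℝ) 1)).withDensity fun τ => ENNReal.ofReal (τ ^ r)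

variable {r : ℝ}

lemma isFiniteMeasure_rpowMeasure (hr : -1 < r) : IsFiniteMeasure (rpowMeasure r) := by
  refine isFiniteMeasure_withDensity_ofReal ?_
  have := intervalIntegral.intervalIntegrable_rpow' (a := 0) (b := 1) hr
  rw [intervalIntegrable_iff_integrableOn_Icc_of_le zero_le_one] at this
  exact this.2

lemma rpowMeasure_real_pos (hr : -1 < r) : 0 < (rpowMeasure r).real (Icc (1 / 4) (3 / 4)) := by
  have := isFiniteMeasure_rpowMeasure hr
  refine ENNReal.toReal_pos (ne_of_gt ?_) (measure_ne_top _ _)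
  rw [rpowMeasure, withDensity_apply _ measurableSet_Icc, setLIntegral_pos_iff (by fun_prop)]
  have hsub : Icc (1 / 4 : ℝ) (3 / 4) ⊆
      (Function.support fun τ : ℝ => ENNReal.ofReal (τ ^ r)) ∩ Icc (1 / 4) (3 / 4) := fun τ hτ => by
    refine ⟨?_, hτ⟩
    have : 0 < τ ^ r := Real.rpow_pos_of_pos (by linarith [hτ.1]) _
    simpa using this
  refine lt_of_lt_of_le ?_ (measure_mono hsub)
  rw [Measure.restrict_apply measurableSet_Icc, inter_eq_left.2
    (Icc_subset_Icc (by norm_num) (by norm_num)), Real.volume_Icc]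
  norm_num

lemma setIntegral_rpowMeasure (k : ℝ → ℝ) :
    ∫ τ in Icc (0 : ℝ) 1, k τ ∂rpowMeasure r = ∫ τ in (0 : ℝ)..1, τ ^ r * k τ := by
  rw [rpowMeasure, setIntegral_withDensity_eq_setIntegral_toReal_smul (by fun_prop)
    (ae_of_all _ fun _ => ENNReal.ofReal_lt_top) _ measurableSet_Icc,
    Measure.restrict_restrict measurableSet_Icc, inter_self,
    intervalIntegral.integral_of_le zero_le_one, ← integral_Icc_eq_integral_Ioc]
  refine setIntegral_congr_fun measurableSet_Icc fun τ hτ => ?_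
  simp [ENNReal.toReal_ofReal (Real.rpow_nonneg hτ.1 r)]

lemma intervalIntegrable_rpow_mul (hr : -1 < r) {h : ℝ → ℝ} (hc : Continuous h) (a b : ℝ) :
    IntervalIntegrable (fun τ => τ ^ r * h τ) volume a b :=
  (intervalIntegral.intervalIntegrable_rpow' hr).mul_continuousOn hc.continuousOn

lemma hasDerivAt_integral_rpow_mul (hr : -1 < r) {h : ℝ → ℝ} (hc : Continuous h) {t : ℝ}
    (ht : 0 < t) : HasDerivAt (fun u => ∫ τ in (0 : ℝ)..u, τ ^ r * h τ) (t ^ r * h t) t := by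
  refine intervalIntegral.integral_hasDerivAt_right (intervalIntegrable_rpow_mul hr hc 0 t) ?_ ?_
  · have : Measurable fun τ : ℝ => τ ^ r * h τ := by
      have := hc.measurable
      fun_prop
    exact this.stronglyMeasurable.stronglyMeasurableAtFilter
  · exact (Real.continuousAt_rpow_const _ _ (Or.inl ht.ne')).mul hc.continuousAt

lemma volterra_rpowMeasure (hr : -1 < r) {s : ℝ} {h : ℝ → ℝ} (hc : Continuous h) {t : ℝ}
    (ht : t ∈ Icc (0 : ℝ) 1) : volterra (rpowMeasure r) s h t =
      s * t - (t * (∫ τ in (0 : ℝ)..t, τ ^ r * h τ) - ∫ τ in (0 : ℝ)..t, τ ^ r * (τ * h τ)) := by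
  have hc' : Continuous fun τ => max (t - τ) 0 * h τ := by fun_prop
  rw [volterra, setIntegral_rpowMeasure, ← intervalIntegral.integral_add_adjacent_intervals
    (intervalIntegrable_rpow_mul hr hc' 0 t) (intervalIntegrable_rpow_mul hr hc' t 1),
    ← intervalIntegral.integral_const_mul, ← intervalIntegral.integral_sub
    ((intervalIntegrable_rpow_mul hr hc 0 t).const_mul t)
    (intervalIntegrable_rpow_mul hr (by fun_prop) 0 t)]
  have hzero : ∫ τ in t..1, τ ^ r * (max (t - τ) 0 * h τ) = 0 := by
    rw [intervalIntegral.integral_congr (g := fun _ => (0 : ℝ))]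
    · simp
    · intro τ hτ
      rw [uIcc_of_le ht.2] at hτ
      simp [max_eq_right (sub_nonpos.2 hτ.1)]
  rw [hzero, add_zero]
  congr 1
  refine intervalIntegral.integral_congr fun τ hτ => ?_
  rw [uIcc_of_le ht.1] at hτ
  simp only [max_eq_left (sub_nonneg.2 hτ.2)]
  ring

lemma hasDerivAt_volterra_rpowMeasure (hr : -1 < r) {s : ℝ} {h : ℝ → ℝ} (hc : Continuous h)
    {t : ℝ} (ht : t ∈ Ioo (0 : ℝ) 1) : HasDerivAt (volterra (rpowMeasure r) s h)
      (s - ∫ τ in (0 : ℝ)..t, τ ^ r * h τ) t := by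
  have h1 := hasDerivAt_integral_rpow_mul hr hc ht.1
  have h2 := hasDerivAt_integral_rpow_mul hr (h := fun τ => τ * h τ) (by fun_prop) ht.1
  have h3 := ((hasDerivAt_id t).const_mul s).sub (((hasDerivAt_id t).mul h1).sub h2)
  refine (h3.congr_of_eventuallyEq ?_).congr_deriv (by simp; ring)
  filter_upwards [Ioo_mem_nhds ht.1 ht.2] with u hu
  simpa using volterra_rpowMeasure hr hc (Ioo_subset_Icc_self hu)

lemma hasDerivAt_deriv_volterra_rpowMeasure (hr : -1 < r) {s : ℝ} {h : ℝ → ℝ}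
    (hc : Continuous h) {t : ℝ} (ht : t ∈ Ioo (0 : ℝ) 1) :
    HasDerivAt (deriv (volterra (rpowMeasure r) s h)) (-(t ^ r * h t)) t := by
  refine ((hasDerivAt_integral_rpow_mul hr hc ht.1).const_sub s).congr_of_eventuallyEq ?_
  filter_upwards [Ioo_mem_nhds ht.1 ht.2] with u hu
  exact (hasDerivAt_volterra_rpowMeasure hr hc hu).deriv

end PowerWeight

section Nonlinearity

variable {f : ℝ → ℝ → ℝ}

lemma le_mul_of_tendsto_sSup
    (hf : ContinuousOn (fun p : ℝ × ℝ => f p.1 p.2) (Icc 0 1 ×ˢ Ici 0))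
    (hf0 : Tendsto (fun u : ℝ => sSup ((fun t => f t u / u) '' Icc (0 : ℝ) 1)) (𝓝[>] 0) (𝓝 0))
    {ε : ℝ} (hε : 0 < ε) :
    ∃ r, 0 < r ∧ ∀ t ∈ Icc (0 : ℝ) 1, ∀ u ∈ Icc 0 r, f t u ≤ ε * u := by
  obtain ⟨r, hr, hrε⟩ := mem_nhdsGT_iff_exists_Ioc_subset.1 (hf0.eventually_lt_const hε)
  have hpos : ∀ t ∈ Icc (0 : ℝ) 1, ∀ u ∈ Ioc 0 r, f t u ≤ ε * u := fun t ht u hu => by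
    have hcont : ContinuousOn (fun t => f t u / u) (Icc 0 1) :=
      (hf.comp (f := fun t => (t, u)) (by fun_prop) fun t ht => ⟨ht, hu.1.le⟩).div_const u
    have h1 := le_csSup (isCompact_Icc.bddAbove_image hcont) (mem_image_of_mem _ ht)
    exact (div_le_iff₀ hu.1).1 (h1.trans (hrε hu).le)
  refine ⟨r, hr, fun t ht u hu => ?_⟩
  rcases hu.1.eq_or_lt with rfl | hu0
  · have hcont : ContinuousWithinAt (fun u => f t u) (Ioi 0) 0 :=
      ((hf.comp (f := fun u => (t, u)) (by fun_prop) fun u hu => ⟨ht, hu⟩) 0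
        self_mem_Ici).mono Ioi_subset_Ici_self
    have hlin : Tendsto (fun u : ℝ => ε * u) (𝓝[>] 0) (𝓝 (ε * 0)) :=
      (continuous_const_mul ε).continuousWithinAt
    refine le_of_tendsto_of_tendsto hcont hlin ?_
    filter_upwards [Ioc_mem_nhdsGT hr] with u hu using hpos t ht u hu
  · exact hpos t ht u ⟨hu0, hu.2⟩

lemma mul_le_of_tendsto_sInf
    (hfnn : ∀ t ∈ Icc (0 : ℝ) 1, ∀ u, 0 ≤ u → 0 ≤ f t u)
    (hfinf : Tendsto (fun u : ℝ => sInf ((fun t => f t u / u) '' Icc (0 : ℝ) 1)) atTop atTop)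
    (N : ℝ) : ∃ K, 0 < K ∧ ∀ t ∈ Icc (0 : ℝ) 1, ∀ u, K ≤ u → N * u ≤ f t u := by
  obtain ⟨K, hK⟩ := eventually_atTop.1 (hfinf.eventually_ge_atTop N)
  refine ⟨max K 1, by positivity, fun t ht u hu => ?_⟩
  have hu0 : 0 < u := zero_lt_one.trans_le ((le_max_right _ _).trans hu)
  have hbdd : BddBelow ((fun t => f t u / u) '' Icc (0 : ℝ) 1) := by
    refine ⟨0, ?_⟩
    rintro _ ⟨t, ht, rfl⟩
    exact div_nonneg (hfnn t ht u hu0.le) hu0.le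
  exact (le_div_iff₀ hu0).1
    ((hK u ((le_max_left _ _).trans hu)).trans (csInf_le hbdd (mem_image_of_mem _ ht)))

end Nonlinearity

theorem stmt14 (α η lam : ℝ) (hα : α ∈ Set.Ioc (1 : ℝ) 2) (hη : η ∈ Set.Ioc (0 : ℝ) 1)
    (hlam0 : 0 ≤ lam) (hlam : lam < 2 / η ^ 2)
    (f : ℝ → ℝ → ℝ)
    (hf : ContinuousOn (fun p : ℝ × ℝ => f p.1 p.2) (Set.Icc 0 1 ×ˢ Set.Ici 0))
    (hfnn : ∀ t ∈ Set.Icc (0 : ℝ) 1, ∀ u, 0 ≤ u → 0 ≤ f t u)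
    -- `max_{t ∈ [0,1]} f(t,u)/u → 0` as `u → 0⁺`
    (hf0 : Tendsto (fun u : ℝ => sSup ((fun t => f t u / u) '' Set.Icc (0 : ℝ) 1))
      (nhdsWithin 0 (Set.Ioi 0)) (nhds 0))
    -- `min_{t ∈ [0,1]} f(t,u)/u → ∞` as `u → ∞`
    (hfinf : Tendsto (fun u : ℝ => sInf ((fun t => f t u / u) '' Set.Icc (0 : ℝ) 1))
      atTop atTop) :
    ∃ x : ℝ → ℝ, ContinuousOn x (Set.Icc 0 1) ∧
      (∀ t ∈ Set.Icc (0 : ℝ) 1, 0 ≤ x t) ∧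
      (∃ t ∈ Set.Icc (0 : ℝ) 1, x t ≠ 0) ∧
      (∀ t ∈ Set.Ioo (0 : ℝ) 1, DifferentiableAt ℝ x t ∧ DifferentiableAt ℝ (deriv x) t ∧
        t ^ (2 - α) * deriv (deriv x) t + f t (x t) = 0) ∧
      x 0 = 0 ∧ x 1 = lam * ∫ t in (0 : ℝ)..η, x t := by
  have hr : -1 < α - 2 := by linarith [hα.1]
  have := isFiniteMeasure_rpowMeasure hr
  set g : ℝ → ℝ → ℝ := fun τ u => f (projIcc 0 1 zero_le_one τ) (max u 0) with hgdef
  have hgf : ∀ τ ∈ Icc (0 : ℝ) 1, ∀ u, 0 ≤ u → g τ u = f τ u := fun τ hτ u hu => by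
    simp only [hgdef, projIcc_of_mem zero_le_one hτ, max_eq_left hu]
  have hg : Continuous (Function.uncurry g) :=
    hf.comp_continuous (f := fun p : ℝ × ℝ => ((projIcc 0 1 zero_le_one p.1 : ℝ), max p.2 0))
      (by fun_prop) fun p => ⟨Subtype.coe_prop _, le_max_right p.2 0⟩
  have hg0 : ∀ τ ∈ Icc (0 : ℝ) 1, ∀ u, 0 ≤ g τ u := fun τ _ u =>
    hfnn _ (Subtype.coe_prop _) _ (le_max_right _ _)
  have hgz : ∀ τ ∈ Icc (0 : ℝ) 1, ∀ u ≤ 0, g τ u = 0 := fun τ hτ u hu => by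
    obtain ⟨r, hr, hle⟩ := le_mul_of_tendsto_sSup hf hf0 one_pos
    have h1 := hle _ hτ 0 (left_mem_Icc.2 hr.le)
    have h2 := hfnn _ hτ 0 le_rfl
    simp only [hgdef, projIcc_of_mem zero_le_one hτ, max_eq_right hu]
    linarith
  obtain ⟨s, x, hs, hxc, hx, hxB⟩ := exists_integral_solution (rpowMeasure_real_pos hr) hg hg0 hgz
    (fun ε hε => by
      obtain ⟨r, hr, hle⟩ := le_mul_of_tendsto_sSup hf hf0 hε
      exact ⟨r, hr, fun τ hτ u hu => by rw [hgf τ hτ u hu.1]; exact hle τ hτ u hu⟩)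
    (fun N => by
      obtain ⟨K, hK, hle⟩ := mul_le_of_tendsto_sInf hfnn hfinf N
      exact ⟨K, hK, fun τ hτ u hu => by rw [hgf τ hτ u (hK.le.trans hu)]; exact hle τ hτ u hu⟩)
    hη hlam0 hlam
  have hh : Continuous fun τ => g τ (x τ) := hg.comp (f := fun τ => (τ, x τ)) (by fun_prop)
  have hxe : x = volterra (rpowMeasure (α - 2)) s fun τ => g τ (x τ) := funext hx
  have hx0 : x 0 = 0 := by rw [hx, volterra_of_nonpos le_rfl, mul_zero]
  have hconc : ConcaveOn ℝ univ x := by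
    rw [hxe]
    exact concaveOn_volterra hh fun τ hτ => hg0 τ hτ _
  have hx1 := hconc.map_one_nonneg hxc hx0 hη hlam0 hlam hxB.ge
  have hxnn : ∀ t ∈ Icc (0 : ℝ) 1, 0 ≤ x t := fun t ht => by
    have := hconc.mul_le_of_map_zero hx0 ht.1 ht.2 1
    rw [mul_one] at this
    exact (mul_nonneg ht.1 hx1).trans this
  refine ⟨x, hxc.continuousOn, hxnn, ?_, fun t ht => ?_, hx0, hxB⟩
  · by_contra! hcon
    have h1 : x 1 = volterra (rpowMeasure (α - 2)) s (fun _ => 0) 1 := by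
      rw [hx]
      exact volterra_congr fun τ hτ _ => hgz τ hτ _ (hcon τ hτ).le
    rw [hcon 1 (right_mem_Icc.2 zero_le_one)] at h1
    simp only [volterra, mul_zero, integral_zero] at h1
    linarith
  · have h1 := hasDerivAt_volterra_rpowMeasure (s := s) hr hh ht
    have h2 := hasDerivAt_deriv_volterra_rpowMeasure (s := s) hr hh ht
    rw [← hxe] at h1 h2
    have ht' := Ioo_subset_Icc_self ht
    refine ⟨h1.differentiableAt, h2.differentiableAt, ?_⟩
    rw [h2.deriv, hgf t ht' _ (hxnn t ht'), mul_neg, ← mul_assoc, ← Real.rpow_add ht.1]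
    simp
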